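/- For a nonzero g ∈ (𝔽_2²)^n let L(g) (resp. R(g)) be the least (resp. greatest) index t with g_t ≠ 0, and let the span length be sl(g) = R(g) − L(g) + 1, with sl(0) = 0. Then: (a) if g_1 ≠ g_2 are nonzero with L(g_1) = L(g_2) = t and g_{1,t} = g_{2,t}, then sl(g_1 + g_2) < max(sl(g_1), sl(g_2)); (b) if g_1, g_2, g_3 are nonzero with L(g_1) = L(g_2) = L(g_3) = t and the entries g_{1,t}, g_{2,t}, g_{3,t} pairwise distinct, then sl(g_1 + g_2 + g_3) < max(sl(g_1), sl(g_2), sl(g_3)). The analogous statements hold with the right index R in place of the left index L (requiring equal, resp. pairwise distinct, entries at the common right index). Consequently, each replacement step of the greedy trellis-oriented-form algorithm strictly decreases the total span length of the matrix, so the algorithm terminates. -/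

import Mathlib

/-- The effective single-qubit Pauli group, identified with the additive group
`𝔽₂²` via `I ↔ (0,0)`, `X ↔ (1,0)`, `Z ↔ (0,1)`, `Y ↔ (1,1)`. -/
abbrev Pauli : Type := ZMod 2 × ZMod 2

/-- `t` is the left index of `g`: the least position where `g` is nonzero. -/
def IsLeftIndex {n : ℕ} (g : Fin n → Pauli) (t : Fin n) : Prop :=
  g t ≠ 0 ∧ ∀ s : Fin n, s < t → g s = 0

/-- `t` is the right index of `g`: the greatest position where `g` is nonzero. -/
def IsRightIndex {n : ℕ} (g : Fin n → Pauli) (t : Fin n) : Prop :=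
  g t ≠ 0 ∧ ∀ s : Fin n, t < s → g s = 0

/-- The matrix with rows `G i` has the L-property: for every index `t`, at most
two rows have left index `t`, and two distinct rows sharing the left index `t`
have different entries at `t`. -/
def LProperty {r n : ℕ} (G : Fin r → Fin n → Pauli) : Prop :=
  (∀ (t : Fin n) (i j : Fin r), i ≠ j →
      IsLeftIndex (G i) t → IsLeftIndex (G j) t → G i t ≠ G j t) ∧
  (∀ (t : Fin n) (i j l : Fin r), i ≠ j → i ≠ l → j ≠ l →
      IsLeftIndex (G i) t → IsLeftIndex (G j) t → ¬ IsLeftIndex (G l) t)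

/-- The matrix with rows `G i` has the R-property (same condition for right
indices). -/
def RProperty {r n : ℕ} (G : Fin r → Fin n → Pauli) : Prop :=
  (∀ (t : Fin n) (i j : Fin r), i ≠ j →
      IsRightIndex (G i) t → IsRightIndex (G j) t → G i t ≠ G j t) ∧
  (∀ (t : Fin n) (i j l : Fin r), i ≠ j → i ≠ l → j ≠ l →
      IsRightIndex (G i) t → IsRightIndex (G j) t → ¬ IsRightIndex (G l) t)

/-- `G` is an LR-matrix (is in trellis-oriented form). -/
def LRMatrix {r n : ℕ} (G : Fin r → Fin n → Pauli) : Prop :=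
  LProperty G ∧ RProperty G

/-- The span length of a vector: `R(g) − L(g) + 1` for `g ≠ 0` (realized as the
largest value of `s − t + 1` over positions `t, s` in the support of `g`), and
`0` for `g = 0`. -/
noncomputable def spanLen {n : ℕ} (g : Fin n → Pauli) : ℕ :=
  sSup {d | ∃ t s : Fin n, g t ≠ 0 ∧ g s ≠ 0 ∧ d = (s : ℕ) - (t : ℕ) + 1}

theorem spanLen_lt_iff {n : ℕ} {g : Fin n → Pauli} {m : ℕ} (hm : 0 < m) :
    spanLen g < m ↔ ∀ t s : Fin n, g t ≠ 0 → g s ≠ 0 → (s : ℕ) - (t : ℕ) + 1 < m := by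
  have bdd : BddAbove {d | ∃ t s : Fin n, g t ≠ 0 ∧ g s ≠ 0 ∧ d = (s : ℕ) - (t : ℕ) + 1} := by
    refine ⟨n, ?_⟩
    rintro d ⟨t, s, -, -, rfl⟩
    omega
  refine ⟨fun h t s ht hs => (le_csSup bdd ⟨t, s, ht, hs, rfl⟩).trans_lt h, fun h => ?_⟩
  rcases Set.eq_empty_or_nonempty
    {d | ∃ t s : Fin n, g t ≠ 0 ∧ g s ≠ 0 ∧ d = (s : ℕ) - (t : ℕ) + 1} with he | hne
  · rwa [spanLen, he, csSup_empty]
  · obtain ⟨t, s, ht, hs, hd⟩ := Nat.sSup_mem hne bdd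
    rw [spanLen, hd]
    exact h t s ht hs

theorem le_spanLen {n : ℕ} {g : Fin n → Pauli} {t s : Fin n} (ht : g t ≠ 0) (hs : g s ≠ 0) :
    (s : ℕ) - (t : ℕ) + 1 ≤ spanLen g :=
  Nat.le_of_lt_succ ((spanLen_lt_iff (Nat.succ_pos _)).1 (Nat.lt_succ_self _) t s ht hs)

theorem sup_spanLen_pos {n : ℕ} {A : Finset (Fin n → Pauli)} (hA : A.Nonempty) {t : Fin n}
    (ht : ∀ g ∈ A, g t ≠ 0) : 0 < A.sup spanLen := by
  obtain ⟨g, hg⟩ := hA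
  have := le_spanLen (ht g hg) (ht g hg)
  have := Finset.le_sup (f := spanLen) hg
  omega

/-- If vectors share the left index `t` and their entries at `t` sum to zero, their sum has
smaller span length than the longest of them. -/
theorem spanLen_sum_lt_of_isLeftIndex {n : ℕ} {A : Finset (Fin n → Pauli)} (hA : A.Nonempty)
    {t : Fin n} (hL : ∀ g ∈ A, IsLeftIndex g t) (h0 : ∑ g ∈ A, g t = 0) :
    spanLen (∑ g ∈ A, g) < A.sup spanLen := by
  have supp : ∀ s, (∑ g ∈ A, g) s ≠ 0 → t < s ∧ ∃ g ∈ A, g s ≠ 0 := by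
    intro s hs
    rw [Finset.sum_apply] at hs
    obtain ⟨g, hg, hgs⟩ := Finset.exists_ne_zero_of_sum_ne_zero hs
    refine ⟨lt_of_le_of_ne (not_lt.1 fun hst => hgs ((hL g hg).2 s hst)) ?_, g, hg, hgs⟩
    rintro rfl
    exact hs h0
  refine (spanLen_lt_iff (sup_spanLen_pos hA fun g hg => (hL g hg).1)).2 fun p q hp hq => ?_
  have htp := (supp p hp).1
  obtain ⟨htq, g, hg, hgq⟩ := supp q hq
  have := le_spanLen (hL g hg).1 hgq
  have := Finset.le_sup (f := spanLen) hg
  omega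

/-- If vectors share the right index `t` and their entries at `t` sum to zero, their sum has
smaller span length than the longest of them. -/
theorem spanLen_sum_lt_of_isRightIndex {n : ℕ} {A : Finset (Fin n → Pauli)} (hA : A.Nonempty)
    {t : Fin n} (hR : ∀ g ∈ A, IsRightIndex g t) (h0 : ∑ g ∈ A, g t = 0) :
    spanLen (∑ g ∈ A, g) < A.sup spanLen := by
  have supp : ∀ s, (∑ g ∈ A, g) s ≠ 0 → s < t ∧ ∃ g ∈ A, g s ≠ 0 := by
    intro s hs
    rw [Finset.sum_apply] at hs
    obtain ⟨g, hg, hgs⟩ := Finset.exists_ne_zero_of_sum_ne_zero hs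
    refine ⟨lt_of_le_of_ne (not_lt.1 fun hts => hgs ((hR g hg).2 s hts)) ?_, g, hg, hgs⟩
    rintro rfl
    exact hs h0
  refine (spanLen_lt_iff (sup_spanLen_pos hA fun g hg => (hR g hg).1)).2 fun p q hp hq => ?_
  have hqt := (supp q hq).1
  obtain ⟨hpt, g, hg, hgp⟩ := supp p hp
  have := le_spanLen hgp (hR g hg).1
  have := Finset.le_sup (f := spanLen) hg
  omega

theorem Pauli.add_self (a : Pauli) : a + a = 0 := by
  revert a
  decide

theorem Pauli.add_add_eq_zero {a b c : Pauli} (ha : a ≠ 0) (hb : b ≠ 0) (hc : c ≠ 0)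
    (hab : a ≠ b) (hac : a ≠ c) (hbc : b ≠ c) : a + b + c = 0 := by
  revert a b c
  decide

/-- **Span lengths decrease under the greedy TOF replacements.**
(a) If two distinct nonzero rows share the left index `t` and have equal
entries at `t`, the span length of their sum is smaller than the maximum of
their span lengths.  (b) If three nonzero rows share the left index `t` with
pairwise distinct entries at `t`, the span length of their sum is smaller than
the maximum of their span lengths.  The analogous statements hold for right
indices.  (Hence each step of the greedy trellis-oriented-form algorithm
strictly decreases the total span length, so it terminates.) -/
theorem spanLen_decreases_greedy_TOF {n : ℕ} :
    (∀ (g₁ g₂ : Fin n → Pauli) (t : Fin n), g₁ ≠ g₂ → g₁ ≠ 0 → g₂ ≠ 0 →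
      IsLeftIndex g₁ t → IsLeftIndex g₂ t → g₁ t = g₂ t →
      spanLen (g₁ + g₂) < max (spanLen g₁) (spanLen g₂)) ∧
    (∀ (g₁ g₂ g₃ : Fin n → Pauli) (t : Fin n), g₁ ≠ 0 → g₂ ≠ 0 → g₃ ≠ 0 →
      IsLeftIndex g₁ t → IsLeftIndex g₂ t → IsLeftIndex g₃ t →
      g₁ t ≠ g₂ t → g₁ t ≠ g₃ t → g₂ t ≠ g₃ t →
      spanLen (g₁ + g₂ + g₃) < max (spanLen g₁) (max (spanLen g₂) (spanLen g₃))) ∧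
    (∀ (g₁ g₂ : Fin n → Pauli) (t : Fin n), g₁ ≠ g₂ → g₁ ≠ 0 → g₂ ≠ 0 →
      IsRightIndex g₁ t → IsRightIndex g₂ t → g₁ t = g₂ t →
      spanLen (g₁ + g₂) < max (spanLen g₁) (spanLen g₂)) ∧
    (∀ (g₁ g₂ g₃ : Fin n → Pauli) (t : Fin n), g₁ ≠ 0 → g₂ ≠ 0 → g₃ ≠ 0 →
      IsRightIndex g₁ t → IsRightIndex g₂ t → IsRightIndex g₃ t →
      g₁ t ≠ g₂ t → g₁ t ≠ g₃ t → g₂ t ≠ g₃ t →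
      spanLen (g₁ + g₂ + g₃) < max (spanLen g₁) (max (spanLen g₂) (spanLen g₃))) := by
  refine ⟨?_, ?_, ?_, ?_⟩
  · intro g₁ g₂ t hne _ _ h₁ h₂ h
    have key := spanLen_sum_lt_of_isLeftIndex (A := {g₁, g₂}) (by simp) (t := t)
      (by simp [h₁, h₂]) (by rw [Finset.sum_pair hne, h, Pauli.add_self])
    simpa [Finset.sum_pair hne] using key
  · intro g₁ g₂ g₃ t _ _ _ h₁ h₂ h₃ h₁₂ h₁₃ h₂₃
    have hn : g₁ ∉ ({g₂, g₃} : Finset (Fin n → Pauli)) := by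
      simpa using ⟨ne_of_apply_ne (· t) h₁₂, ne_of_apply_ne (· t) h₁₃⟩
    have hp : g₂ ≠ g₃ := ne_of_apply_ne (· t) h₂₃
    have key := spanLen_sum_lt_of_isLeftIndex (A := {g₁, g₂, g₃}) (by simp) (t := t)
      (by simp [h₁, h₂, h₃]) (by
        rw [Finset.sum_insert hn, Finset.sum_pair hp, ← add_assoc]
        exact Pauli.add_add_eq_zero h₁.1 h₂.1 h₃.1 h₁₂ h₁₃ h₂₃)
    rw [Finset.sum_insert hn, Finset.sum_pair hp, ← add_assoc] at key
    simpa using key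
  · intro g₁ g₂ t hne _ _ h₁ h₂ h
    have key := spanLen_sum_lt_of_isRightIndex (A := {g₁, g₂}) (by simp) (t := t)
      (by simp [h₁, h₂]) (by rw [Finset.sum_pair hne, h, Pauli.add_self])
    simpa [Finset.sum_pair hne] using key
  · intro g₁ g₂ g₃ t _ _ _ h₁ h₂ h₃ h₁₂ h₁₃ h₂₃
    have hn : g₁ ∉ ({g₂, g₃} : Finset (Fin n → Pauli)) := by
      simpa using ⟨ne_of_apply_ne (· t) h₁₂, ne_of_apply_ne (· t) h₁₃⟩
    have hp : g₂ ≠ g₃ := ne_of_apply_ne (· t) h₂₃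
    have key := spanLen_sum_lt_of_isRightIndex (A := {g₁, g₂, g₃}) (by simp) (t := t)
      (by simp [h₁, h₂, h₃]) (by
        rw [Finset.sum_insert hn, Finset.sum_pair hp, ← add_assoc]
        exact Pauli.add_add_eq_zero h₁.1 h₂.1 h₃.1 h₁₂ h₁₃ h₂₃)
    rw [Finset.sum_insert hn, Finset.sum_pair hp, ← add_assoc] at key
    simpa using key
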